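/- arXiv:1910.08718 — 4 statements merged into one kernel-verified Lean document; each statement's English description precedes it below -/
import Mathlib

section
/- Let G = (V, E, w) be a finite directed weighted graph that contains at least one cycle. Then the infimum of the mean weight w̄(c) over all cycles c of G is attained, and it is attained by a simple cycle; in particular, the minimum mean weight over all cycles of G equals the minimum mean weight over the (finitely many) simple cycles of G. -/
/-- `p` is a path (walk) in the directed graph with edge relation `E`:
a nonempty list of vertices with consecutive vertices joined by edges. -/
def IsWalk {V : Type*} (E : V → V → Prop) (p : List V) : Prop :=
  p ≠ [] ∧ p.Chain' E

/-- The multiset of edges of a path, counted with multiplicity. -/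
def edgeMS {V : Type*} (p : List V) : Multiset (V × V) :=
  ↑(p.zip p.tail)

/-- The number of edges ψ(p) of a path. -/
def numEdges {V : Type*} (p : List V) : ℕ := p.length - 1

/-- The weight of a path: the sum of the weights of its edges. -/
def pathWeight {V : Type*} (w : V → V → ℝ) (p : List V) : ℝ :=
  ((p.zip p.tail).map (fun e => w e.1 e.2)).sum

/-- A cycle: a path with at least one edge whose first and last vertices coincide. -/
def IsCycle {V : Type*} (E : V → V → Prop) (p : List V) : Prop :=
  IsWalk E p ∧ 2 ≤ p.length ∧ p.head? = p.getLast?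

/-- A simple cycle: a cycle ⟨v₀, …, v_k, v₀⟩ whose vertices v₀, …, v_k are pairwise
distinct (i.e. no repeated vertices except first = last). -/
def IsSimpleCycle {V : Type*} (E : V → V → Prop) (p : List V) : Prop :=
  IsCycle E p ∧ p.dropLast.Nodup

/-- The mean weight w̄(c) = w(c)/ψ(c) of a cycle (or path). -/
noncomputable def meanWeight {V : Type*} (w : V → V → ℝ) (p : List V) : ℝ :=
  pathWeight w p / (numEdges p : ℝ)

theorem pathWeight_append {V : Type*} (w : V → V → ℝ) (p q : List V) (x : V) :
    pathWeight w (p ++ x :: q) = pathWeight w (p ++ [x]) + pathWeight w (x :: q) := by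
  induction p with
  | nil => simp [pathWeight]
  | cons a p ih =>
    cases p with
    | nil => simp [pathWeight]
    | cons b p =>
      simp only [pathWeight, List.cons_append, List.tail_cons, List.zip_cons_cons,
        List.map_cons, List.sum_cons] at ih ⊢
      linarith

theorem exists_append_of_not_nodup {V : Type*} {l : List V} (h : ¬ l.Nodup) :
    ∃ A x B C, l = A ++ x :: (B ++ x :: C) := by
  induction l with
  | nil => simp at h
  | cons a l ih =>
    by_cases ha : a ∈ l
    · obtain ⟨B, C, rfl⟩ := List.append_of_mem ha
      exact ⟨[], a, B, C, rfl⟩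
    · obtain ⟨A, x, B, C, rfl⟩ := ih fun hl => h (List.nodup_cons.2 ⟨ha, hl⟩)
      exact ⟨a :: A, x, B, C, rfl⟩

/-- A cycle that is not simple splits at a repeated vertex into two shorter cycles. -/
theorem IsCycle.exists_split {V : Type*} {E : V → V → Prop} (w : V → V → ℝ) {c : List V}
    (hc : IsCycle E c) (hd : ¬ c.dropLast.Nodup) :
    ∃ c₁ c₂, IsCycle E c₁ ∧ IsCycle E c₂ ∧ numEdges c = numEdges c₁ + numEdges c₂ ∧
      pathWeight w c = pathWeight w c₁ + pathWeight w c₂ := by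
  obtain ⟨⟨hne, hch⟩, -, hhd⟩ := hc
  obtain ⟨A, x, B, C, hl⟩ := exists_append_of_not_nodup hd
  obtain ⟨z, hz⟩ : ∃ z, c = A ++ x :: (B ++ x :: (C ++ [z])) :=
    ⟨c.getLast hne, by
      conv_lhs => rw [← List.dropLast_append_getLast hne, hl]
      simp⟩
  subst hz
  change List.IsChain E _ at hch
  obtain ⟨hA, hBC⟩ := List.isChain_split.1 hch
  rw [← List.cons_append, List.isChain_split] at hBC
  obtain ⟨hB, hC⟩ := hBC
  refine ⟨x :: (B ++ [x]), A ++ x :: (C ++ [z]), ⟨⟨by simp, hB⟩, by simp, ?_⟩,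
    ⟨⟨by simp, List.isChain_split.2 ⟨hA, hC⟩⟩, by simp; omega, ?_⟩, ?_, ?_⟩
  · rw [← List.cons_append, List.getLast?_concat]; rfl
  · cases A <;> simp_all [List.getLast?_cons, List.getLast?_append]
  · simp [numEdges]; omega
  · rw [pathWeight_append w A, pathWeight_append w A (C ++ [z]), ← List.cons_append,
      pathWeight_append w (x :: B)]
    simp only [List.cons_append]
    ring

theorem IsCycle.numEdges_pos {V : Type*} {E : V → V → Prop} {c : List V} (hc : IsCycle E c) :
    0 < numEdges c := by
  have := hc.2.1
  unfold numEdges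
  omega

/-- A lower bound for the mean weight of all simple cycles bounds every cycle. -/
theorem le_meanWeight_of_forall_isSimpleCycle {V : Type*} {E : V → V → Prop} {w : V → V → ℝ}
    {μ : ℝ} (hμ : ∀ s, IsSimpleCycle E s → μ ≤ meanWeight w s) {c : List V}
    (hc : IsCycle E c) : μ ≤ meanWeight w c := by
  induction hn : numEdges c using Nat.strong_induction_on generalizing c with
  | _ n ih =>
    by_cases hd : c.dropLast.Nodup
    · exact hμ c ⟨hc, hd⟩
    · obtain ⟨c₁, c₂, h₁, h₂, hnum, hw⟩ := hc.exists_split w hd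
      have p₁ := h₁.numEdges_pos
      have p₂ := h₂.numEdges_pos
      have i₁ := ih _ (by omega) h₁ rfl
      have i₂ := ih _ (by omega) h₂ rfl
      unfold meanWeight at *
      rw [le_div_iff₀ (by exact_mod_cast p₁)] at i₁
      rw [le_div_iff₀ (by exact_mod_cast p₂)] at i₂
      rw [le_div_iff₀ (by exact_mod_cast hc.numEdges_pos), hnum, hw]
      push_cast
      linarith

theorem IsCycle.exists_isSimpleCycle {V : Type*} {E : V → V → Prop} {c : List V}
    (hc : IsCycle E c) : ∃ s, IsSimpleCycle E s := by
  by_contra! h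
  have := le_meanWeight_of_forall_isSimpleCycle (w := fun _ _ => 0)
    (μ := meanWeight (fun _ _ => 0) c + 1) (fun s hs => (h s hs).elim) hc
  linarith

theorem finite_setOf_isSimpleCycle {V : Type*} [Fintype V] (E : V → V → Prop) :
    {s : List V | IsSimpleCycle E s}.Finite := by
  refine (List.finite_length_le V (Fintype.card V + 1)).subset fun s hs => ?_
  have := hs.2.length_le_card
  simp only [List.length_dropLast, Set.mem_ofPred_eq] at this ⊢
  omega


/-- Lemma 4, existence of a simple minimum-mean cycle.
In a finite directed weighted graph containing at least one cycle, the infimum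
of the mean weight over all cycles is attained, and attained by a simple cycle;
in particular the minimum mean weight over all cycles equals the minimum mean
weight over simple cycles. -/
theorem stmt4 {V : Type*} [Fintype V] (E : V → V → Prop) (w : V → V → ℝ)
    (hcyc : ∃ c : List V, IsCycle E c) :
    ∃ c' : List V, IsSimpleCycle E c' ∧
      IsLeast {μ : ℝ | ∃ c, IsCycle E c ∧ μ = meanWeight w c} (meanWeight w c') ∧
      IsLeast {μ : ℝ | ∃ c, IsSimpleCycle E c ∧ μ = meanWeight w c} (meanWeight w c') := by
  obtain ⟨c, hc⟩ := hcyc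
  obtain ⟨s, hs, hmin⟩ := Set.exists_min_image _ (meanWeight w) (finite_setOf_isSimpleCycle E)
    hc.exists_isSimpleCycle
  refine ⟨s, hs, ⟨⟨s, hs.1, rfl⟩, ?_⟩, ⟨s, hs, rfl⟩, ?_⟩
  · rintro _ ⟨d, hd, rfl⟩
    exact le_meanWeight_of_forall_isSimpleCycle hmin hd
  · rintro _ ⟨d, hd, rfl⟩
    exact hmin d hd
end

section
/- (Karp's characterization.) Let G = (V, E, w) be a finite directed weighted graph containing at least one cycle, and let o ∈ V be a source vertex from which every vertex of V is reachable. Then the minimum mean weight over all cycles of G satisfies μ* = min_{v ∈ V} max_{0 ≤ k ≤ |V| − 1} (F(|V|, v) − F(k, v)) / (|V| − k), where the inner maximum is taken over those k with F(k, v) < ∞, and a vertex v with F(|V|, v) = ∞ is excluded from the outer minimum (equivalently, its inner expression is +∞). -/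
/-- `FVal E w o k v` is Karp's quantity `F(k, v)`: the minimum weight over all
paths from the source `o` to `v` having exactly `k` edges, and `+∞` (the top
element of `EReal`) if no such path exists. -/
noncomputable def FVal {V : Type*} (E : V → V → Prop) (w : V → V → ℝ) (o : V)
    (k : ℕ) (v : V) : EReal :=
  sInf {x : EReal | ∃ p : List V, IsWalk E p ∧ p.head? = some o ∧
    p.getLast? = some v ∧ numEdges p = k ∧ x = (pathWeight w p : EReal)}

/-- `HasWalk E w k u v x`: some walk from `u` to `v` has exactly `k` edges and weight `x`. -/
inductive HasWalk {V : Type*} (E : V → V → Prop) (w : V → V → ℝ) : ℕ → V → V → ℝ → Prop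
  | nil (u : V) : HasWalk E w 0 u u 0
  | cons {k : ℕ} {u v z : V} {x : ℝ} (h : E u v) (hp : HasWalk E w k v z x) :
      HasWalk E w (k + 1) u z (w u v + x)

namespace HasWalk

variable {V : Type*} {E : V → V → Prop} {w : V → V → ℝ} {k l : ℕ} {u v z : V} {x y : ℝ}

theorem trans (h : HasWalk E w k u v x) (h' : HasWalk E w l v z y) :
    HasWalk E w (k + l) u z (x + y) := by
  induction h with
  | nil u => simpa using h'
  | cons e _ ih =>
    have := cons e (ih h')
    rwa [← add_assoc, Nat.add_right_comm] at this

theorem split (h : HasWalk E w (k + l) u v x) :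
    ∃ z a b, HasWalk E w k u z a ∧ HasWalk E w l z v b ∧ x = a + b := by
  induction k generalizing u x with
  | zero => exact ⟨u, 0, x, nil u, by simpa using h, by simp⟩
  | succ k ih =>
    rw [Nat.add_right_comm] at h
    obtain _ | ⟨e, hp⟩ := h
    obtain ⟨z, a, b, ha, hb, rfl⟩ := ih hp
    exact ⟨z, _, b, cons e ha, hb, by ring⟩

theorem iterate (h : HasWalk E w k u u x) (j : ℕ) : HasWalk E w (j * k) u u (j * x) := by
  induction j with
  | zero => simpa using nil u
  | succ j ih =>
    have := ih.trans h
    rw [Nat.succ_mul]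
    convert this using 1
    push_cast
    ring

theorem exists_fun (h : HasWalk E w k u v x) :
    ∃ p : ℕ → V, p 0 = u ∧ p k = v ∧ (∀ i < k, E (p i) (p (i + 1))) ∧
      x = ∑ i ∈ Finset.range k, w (p i) (p (i + 1)) := by
  induction h with
  | nil u => exact ⟨fun _ => u, rfl, rfl, by simp, by simp⟩
  | @cons k u v z x e _ ih =>
    obtain ⟨p, h0, hk, hE, hx⟩ := ih
    refine ⟨fun i => Nat.casesOn i u p, rfl, hk, ?_, ?_⟩
    · rintro (_ | i) hi
      · simpa [h0] using e
      · exact hE i (by omega)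
    · rw [Finset.sum_range_succ', hx, add_comm]
      simp [h0]

theorem of_fun (p : ℕ → V) (a k : ℕ) (h : ∀ i < k, E (p (a + i)) (p (a + i + 1))) :
    HasWalk E w k (p a) (p (a + k)) (∑ i ∈ Finset.range k, w (p (a + i)) (p (a + i + 1))) := by
  induction k generalizing a with
  | zero => simpa using nil (p a)
  | succ k ih =>
    have := ih (a + 1) fun i hi => by
      have := h (i + 1) (by omega)
      rwa [show a + 1 + i = a + (i + 1) by ring]
    rw [Finset.sum_range_succ', add_comm (Finset.sum _ _)]
    have := cons (w := w) (h 0 (by omega)) this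
    simpa only [add_zero, show ∀ i, a + 1 + i = a + (i + 1) by intro i; ring,
      add_comm k 1, add_assoc] using this

/-- A walk with at least `|V|` edges contains a nontrivial closed walk. -/
theorem exists_closed [Fintype V] (h : HasWalk E w k u v x) (hk : Fintype.card V ≤ k) :
    ∃ a b c z r s t, k = a + b + c ∧ 0 < b ∧ x = r + s + t ∧
      HasWalk E w a u z r ∧ HasWalk E w b z z s ∧ HasWalk E w c z v t := by
  obtain ⟨p, rfl, rfl, hE, rfl⟩ := h.exists_fun
  obtain ⟨i, j, hij, hp⟩ : ∃ i j : Fin (k + 1), i < j ∧ p i = p j := by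
    obtain ⟨i, j, hne, hp⟩ := Fintype.exists_ne_map_eq_of_card_lt
      (fun i : Fin (k + 1) => p i) (by simpa using Nat.lt_succ_of_le hk)
    rcases lt_or_gt_of_ne hne with hlt | hlt
    · exact ⟨i, j, hlt, hp⟩
    · exact ⟨j, i, hlt, hp.symm⟩
  obtain ⟨b, hb⟩ := Nat.exists_eq_add_of_lt (Fin.lt_def.1 hij)
  obtain ⟨c, hc⟩ := Nat.exists_eq_add_of_le (Nat.le_of_lt_succ j.2)
  generalize (i : ℕ) = a at *
  generalize (j : ℕ) = d at *
  subst hb hc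
  have h1 := of_fun (w := w) p 0 a fun i hi => by simpa using hE i (by omega)
  have h2 := of_fun (w := w) p a (b + 1) fun i hi => hE _ (by omega)
  have h3 := of_fun (w := w) p (a + b + 1) c fun i hi => hE _ (by omega)
  simp only [zero_add] at h1
  rw [← add_assoc, ← hp] at h2
  rw [← hp] at h3
  refine ⟨a, b + 1, c, p a, _, _, _, rfl, by omega, ?_, h1, h2, h3⟩
  rw [Finset.sum_range_add, add_assoc a b 1, Finset.sum_range_add]

theorem finite_weights [Finite V] (k : ℕ) (u v : V) : {x | HasWalk E w k u v x}.Finite := by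
  induction k generalizing u with
  | zero =>
    refine (Set.finite_singleton 0).subset ?_
    rintro x (_ | _)
    rfl
  | succ k ih =>
    refine (Set.finite_iUnion fun z => (ih z).image (w u z + ·)).subset ?_
    rintro x (_ | ⟨e, hp⟩)
    exact Set.mem_iUnion.2 ⟨_, _, hp, rfl⟩

theorem of_isWalk {p : List V} (hp : IsWalk E p) (hu : p.head? = some u)
    (hv : p.getLast? = some v) : HasWalk E w (numEdges p) u v (pathWeight w p) := by
  obtain ⟨hne, hc⟩ := hp
  induction p generalizing u with
  | nil => exact absurd rfl hne
  | cons a q ih =>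
    obtain rfl : a = u := by simpa using hu
    cases q with
    | nil =>
      obtain rfl : a = v := by simpa using hv
      simpa [numEdges, pathWeight] using nil (E := E) (w := w) a
    | cons b q =>
      obtain ⟨hab, hq⟩ := List.isChain_cons_cons.1 hc
      have := cons hab (ih (u := b) rfl (by simpa using hv) (by simp) hq)
      simpa [numEdges, pathWeight] using this

theorem exists_isWalk (h : HasWalk E w k u v x) :
    ∃ p : List V, IsWalk E p ∧ p.head? = some u ∧ p.getLast? = some v ∧ numEdges p = k ∧
      x = pathWeight w p := by
  induction h with
  | nil u => exact ⟨[u], ⟨by simp, List.isChain_singleton u⟩, rfl, rfl, rfl, by simp [pathWeight]⟩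
  | @cons k u v z x e _ ih =>
    obtain ⟨p, ⟨hne, hc⟩, hu, hv, hk, hx⟩ := ih
    obtain _ | ⟨a, q⟩ := p
    · exact absurd rfl hne
    obtain rfl : a = v := by simpa using hu
    refine ⟨u :: a :: q, ⟨by simp, List.isChain_cons_cons.2 ⟨e, hc⟩⟩, rfl, by simpa using hv, ?_, ?_⟩
    · simpa [numEdges] using hk
    · rw [hx]
      simp [pathWeight]

theorem fVal_ne_top (h : HasWalk E w k u v x) : FVal E w u k v ≠ ⊤ := by
  obtain ⟨p, h1, h2, h3, h4, rfl⟩ := h.exists_isWalk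
  exact ne_top_of_le_ne_top (EReal.coe_ne_top _) (sInf_le ⟨p, h1, h2, h3, h4, rfl⟩)

end HasWalk

section Karp

variable {V : Type*} {E : V → V → Prop} {w : V → V → ℝ} {k : ℕ} {u v : V} {x μ : ℝ}

/-- A finite value `F(k, v)` is attained by a walk. -/
theorem exists_hasWalk_fVal_toReal [Finite V] (h : FVal E w u k v ≠ ⊤) :
    HasWalk E w k u v (FVal E w u k v).toReal ∧
      ∀ y, HasWalk E w k u v y → (FVal E w u k v).toReal ≤ y := by
  have hne : {x | HasWalk E w k u v x}.Nonempty := by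
    by_contra hempty
    refine h (sInf_eq_top.2 ?_)
    rintro _ ⟨p, h1, h2, h3, rfl, rfl⟩
    exact absurd ⟨_, HasWalk.of_isWalk h1 h2 h3⟩ hempty
  obtain ⟨x, hx, hmin⟩ := Set.exists_min_image _ id (HasWalk.finite_weights k u v) hne
  have hF : FVal E w u k v = x := by
    refine IsLeast.csInf_eq ⟨?_, ?_⟩
    · obtain ⟨p, h1, h2, h3, h4, rfl⟩ := hx.exists_isWalk
      exact ⟨p, h1, h2, h3, h4, rfl⟩
    · rintro _ ⟨p, h1, h2, h3, rfl, rfl⟩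
      exact EReal.coe_le_coe_iff.2 (hmin _ (HasWalk.of_isWalk h1 h2 h3))
  rw [hF, EReal.toReal_coe]
  exact ⟨hx, hmin⟩

/-- Deleting closed walks shortens any walk below `|V|` edges without increasing its weight
reduced by `μ` per edge. -/
theorem HasWalk.exists_short [Fintype V]
    (hμ : ∀ k u x, 0 < k → HasWalk E w k u u x → μ * k ≤ x) (h : HasWalk E w k u v x) :
    ∃ l < Fintype.card V, ∃ y, HasWalk E w l u v y ∧ y - μ * l ≤ x - μ * k := by
  induction k using Nat.strong_induction_on generalizing x with
  | _ k ih =>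
    rcases lt_or_ge k (Fintype.card V) with hk | hk
    · exact ⟨k, hk, x, h, le_rfl⟩
    obtain ⟨a, b, c, z, r, s, t, rfl, hb, rfl, h1, h2, h3⟩ := h.exists_closed hk
    obtain ⟨l, hl, y, hy, hle⟩ := ih (a + c) (by omega) (h1.trans h3)
    refine ⟨l, hl, y, hy, hle.trans ?_⟩
    have := hμ b z s hb h2
    push_cast
    linarith

/-- If a closed walk through `u` has mean weight `μ`, then some walk with exactly `|V|` edges
minimizes the weight reduced by `μ` per edge among all walks with the same endpoints. -/
theorem exists_card_walk_minimal [Fintype V] {o : V}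
    (hμ : ∀ k u x, 0 < k → HasWalk E w k u u x → μ * k ≤ x)
    (hreach : ∃ k x, HasWalk E w k o u x) (hk : 0 < k) (hu : HasWalk E w k u u (μ * k)) :
    ∃ v x, HasWalk E w (Fintype.card V) o v x ∧
      ∀ l y, HasWalk E w l o v y → x - μ * Fintype.card V ≤ y - μ * l := by
  obtain ⟨l₀, x₀, h₀⟩ := hreach
  obtain ⟨l₁, hl₁, x₁, h₁, -⟩ := h₀.exists_short hμ
  have hfin : {q : ℕ × ℝ | q.1 < Fintype.card V ∧ HasWalk E w q.1 o u q.2}.Finite := by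
    refine ((Set.finite_lt_nat (Fintype.card V)).biUnion fun l _ =>
      (HasWalk.finite_weights (E := E) (w := w) l o u).image (Prod.mk l)).subset ?_
    rintro ⟨l, x⟩ ⟨hl, hx⟩
    exact Set.mem_biUnion hl ⟨x, hx, rfl⟩
  obtain ⟨⟨l, x⟩, ⟨hl, hx⟩, hmin⟩ := Set.exists_min_image _
    (fun q : ℕ × ℝ => q.2 - μ * q.1) hfin ⟨(l₁, x₁), hl₁, h₁⟩
  dsimp only at hl hx
  obtain ⟨m, hm⟩ := Nat.exists_eq_add_of_le hl.le
  obtain ⟨d, hd⟩ := Nat.exists_eq_add_of_le (Nat.le_mul_of_pos_right m hk)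
  have hloop := hu.iterate m
  rw [hd] at hloop
  obtain ⟨v, a, b, ha, hb, hab⟩ := hloop.split
  refine ⟨v, x + a, hm ▸ hx.trans ha, fun j y hy => ?_⟩
  obtain ⟨l', hl', y', hy', hle⟩ := (hy.trans hb).exists_short hμ
  have h1 := hmin (l', y') ⟨hl', hy'⟩
  have h2 : (Fintype.card V : ℝ) = l + m := by exact_mod_cast hm
  have h3 : (m : ℝ) * k = m + d := by exact_mod_cast hd
  have h4 : (m : ℝ) * (μ * k) = μ * (m + d) := by rw [← h3]; ring
  rw [h2]
  push_cast at hle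
  dsimp only at h1
  linarith

end Karp

/-- Karp's characterization of the minimum mean cycle weight.
Let `G` be a finite directed weighted graph containing at least one cycle and
let `o` be a source vertex from which every vertex is reachable. If `μ` is the
minimum mean weight over all cycles, then
`μ = min_{v : F(n,v) < ∞} max_{0 ≤ k ≤ n−1, F(k,v) < ∞} (F(n,v) − F(k,v))/(n − k)`,
where `n = |V|`; vertices `v` with `F(n, v) = ∞` are excluded from the outer
minimum, and the inner maximum ranges over the `k` with `F(k, v) < ∞`. -/
theorem stmt5 {V : Type*} [Fintype V] (E : V → V → Prop) (w : V → V → ℝ) (o : V)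
    (hreach : ∀ v : V, ∃ p : List V,
      IsWalk E p ∧ p.head? = some o ∧ p.getLast? = some v)
    (hcyc : ∃ c : List V, IsCycle E c)
    (μ : ℝ) (hμ : IsLeast {m : ℝ | ∃ c, IsCycle E c ∧ m = meanWeight w c} μ) :
    IsLeast {r : ℝ | ∃ v : V,
      FVal E w o (Fintype.card V) v ≠ ⊤ ∧
      IsGreatest {s : ℝ | ∃ k ≤ Fintype.card V - 1, FVal E w o k v ≠ ⊤ ∧
        s = ((FVal E w o (Fintype.card V) v).toReal - (FVal E w o k v).toReal) /
            ((Fintype.card V : ℝ) - (k : ℝ))} r} μ := by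
  have hcycle : ∀ k u x, 0 < k → HasWalk E w k u u x → μ * k ≤ x := by
    intro k u x hk h
    obtain ⟨p, h1, h2, h3, rfl, rfl⟩ := h.exists_isWalk
    have := hμ.2 ⟨p, ⟨h1, by unfold numEdges at hk; omega, h2.trans h3.symm⟩, rfl⟩
    rwa [meanWeight, le_div_iff₀ (by exact_mod_cast hk)] at this
  have hlower : ∀ v, FVal E w o (Fintype.card V) v ≠ ⊤ → ∃ k ≤ Fintype.card V - 1,
      FVal E w o k v ≠ ⊤ ∧ μ ≤ ((FVal E w o (Fintype.card V) v).toReal -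
        (FVal E w o k v).toReal) / ((Fintype.card V : ℝ) - (k : ℝ)) := by
    intro v hv
    obtain ⟨k, hk, y, hy, hle⟩ := (exists_hasWalk_fVal_toReal hv).1.exists_short hcycle
    refine ⟨k, by omega, hy.fVal_ne_top, ?_⟩
    have hk' : (k : ℝ) < Fintype.card V := by exact_mod_cast hk
    rw [le_div_iff₀ (by linarith)]
    have := (exists_hasWalk_fVal_toReal hy.fVal_ne_top).2 y hy
    linarith
  refine ⟨?_, ?_⟩
  · obtain ⟨c, ⟨hc, hlen, hends⟩, hmean⟩ := hμ.1
    obtain ⟨u, hu⟩ : ∃ u, c.head? = some u := by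
      cases c with
      | nil => simp at hlen
      | cons a q => exact ⟨a, rfl⟩
    have hpos : 0 < numEdges c := by unfold numEdges; omega
    have hloop := HasWalk.of_isWalk (w := w) hc hu (hends ▸ hu)
    rw [meanWeight, eq_div_iff (by exact_mod_cast hpos.ne')] at hmean
    rw [← hmean] at hloop
    obtain ⟨p, hp, hpo, hpu⟩ := hreach u
    obtain ⟨v, x, hx, hmin⟩ := exists_card_walk_minimal hcycle
      ⟨_, _, HasWalk.of_isWalk hp hpo hpu⟩ hpos hloop
    have hupper : ∀ k ≤ Fintype.card V - 1, FVal E w o k v ≠ ⊤ →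
        ((FVal E w o (Fintype.card V) v).toReal - (FVal E w o k v).toReal) /
          ((Fintype.card V : ℝ) - (k : ℝ)) ≤ μ := by
      intro k hk hkv
      have hcard : 0 < Fintype.card V := Fintype.card_pos_iff.2 ⟨o⟩
      have hk' : (k : ℝ) < Fintype.card V := by exact_mod_cast (by omega : k < Fintype.card V)
      rw [div_le_iff₀ (by linarith)]
      have h1 := (exists_hasWalk_fVal_toReal hx.fVal_ne_top).2 x hx
      have h2 := hmin k _ (exists_hasWalk_fVal_toReal hkv).1
      linarith
    refine ⟨v, hx.fVal_ne_top, ?_, ?_⟩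
    · obtain ⟨k, hk, hkv, hle⟩ := hlower v hx.fVal_ne_top
      exact ⟨k, hk, hkv, hle.antisymm (hupper k hk hkv)⟩
    · rintro _ ⟨k, hk, hkv, rfl⟩
      exact hupper k hk hkv
  · rintro r ⟨v, hv, -, hr⟩
    obtain ⟨k, hk, hkv, hle⟩ := hlower v hv
    exact hle.trans (hr ⟨k, hk, hkv, rfl⟩)
end

section
/- Let G = (V, E, w) be a finite directed weighted graph containing at least one cycle, let o ∈ V be a source vertex from which every vertex of V is reachable, and let v* ∈ V (together with an index k*) attain the minimum in Karp's formula μ* = min_{v ∈ V} max_{0 ≤ k ≤ |V| − 1} (F(|V|, v) − F(k, v)) / (|V| − k). Then every cycle contained in a path from o to v* that has exactly |V| edges and weight F(|V|, v*) is a minimum-mean cycle of G, i.e., its mean weight equals μ*. -/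
theorem pathWeight_append_cons {V : Type*} (w : V → V → ℝ) (s : List V) (x : V) (t : List V) :
    pathWeight w (s ++ x :: t) = pathWeight w (s ++ [x]) + pathWeight w (x :: t) := by
  induction s with
  | nil => simp [pathWeight]
  | cons a s ih =>
    cases s with
    | nil => simp [pathWeight]
    | cons b s =>
      simp only [pathWeight, List.cons_append, List.tail_cons, List.zip_cons_cons, List.map_cons,
        List.sum_cons] at ih ⊢
      rw [ih, add_assoc]

/-- Excising a cycle `x :: m ++ [x]` from a path lowers its weight by the weight of the cycle. -/
theorem pathWeight_append_cycle {V : Type*} (w : V → V → ℝ) (s : List V) (x : V) (m t : List V) :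
    pathWeight w (s ++ (x :: m ++ [x]) ++ t) =
      pathWeight w (s ++ x :: t) + pathWeight w (x :: m ++ [x]) := by
  have h₁ := pathWeight_append_cons w (s ++ x :: m) x t
  have h₂ := pathWeight_append_cons w s x (m ++ [x])
  have h₃ := pathWeight_append_cons w s x t
  simp only [List.append_assoc, List.cons_append, List.nil_append] at h₁ h₂ h₃ ⊢
  linarith

theorem IsCycle.exists_eq {V : Type*} {E : V → V → Prop} {c : List V} (hc : IsCycle E c) :
    ∃ x m, c = x :: m ++ [x] := by
  obtain ⟨_, hlen, hends⟩ := hc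
  match c with
  | [] => simp at hlen
  | x :: d =>
    have hd : d ≠ [] := by rintro rfl; simp at hlen
    have hx : x = d.getLast hd := by
      simpa [List.getLast?_cons, List.getLast?_eq_some_getLast hd] using hends
    exact ⟨x, d.dropLast, by simp [List.dropLast_append_getLast, hx]⟩

theorem IsWalk.remove_cycle {V : Type*} {E : V → V → Prop} {s : List V} {x : V} {m t : List V}
    (h : IsWalk E (s ++ (x :: m ++ [x]) ++ t)) : IsWalk E (s ++ x :: t) := by
  refine ⟨by simp, ?_⟩
  have h₀ : List.IsChain E (s ++ (x :: m ++ [x]) ++ t) := h.2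
  have h₁ : List.IsChain E (s ++ x :: (m ++ x :: t)) := by simpa using h₀
  have h₂ : List.IsChain E ((s ++ x :: m) ++ x :: t) := by simpa using h₀
  exact List.isChain_split.2 ⟨(List.isChain_split.1 h₁).1, (List.isChain_split.1 h₂).2⟩

theorem FVal_le {V : Type*} {E : V → V → Prop} (w : V → V → ℝ) {o v : V} {p : List V}
    (hp : IsWalk E p) (ho : p.head? = some o) (hv : p.getLast? = some v) :
    FVal E w o (numEdges p) v ≤ (pathWeight w p : EReal) :=
  sInf_le ⟨p, hp, ho, hv, rfl, rfl⟩

theorem nsmul_numEdges_le_pathWeight {V : Type*} {w : V → V → ℝ} {B : ℝ}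
    (hB : ∀ a b, B ≤ w a b) (p : List V) : numEdges p • B ≤ pathWeight w p := by
  have h := List.card_nsmul_le_sum ((p.zip p.tail).map fun e => w e.1 e.2) B (by
    intro x hx
    obtain ⟨e, -, rfl⟩ := List.mem_map.1 hx
    exact hB _ _)
  simpa [pathWeight, numEdges] using h

theorem FVal_ne_bot {V : Type*} [Finite V] (E : V → V → Prop) (w : V → V → ℝ) (o : V)
    (k : ℕ) (v : V) : FVal E w o k v ≠ ⊥ := by
  obtain ⟨B, hB⟩ := (Set.finite_range fun e : V × V => w e.1 e.2).bddBelow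
  have hle : ((k • B : ℝ) : EReal) ≤ FVal E w o k v := by
    refine le_sInf ?_
    rintro _ ⟨p, -, -, -, rfl, rfl⟩
    exact EReal.coe_le_coe_iff.2
      (nsmul_numEdges_le_pathWeight (fun a b => hB ⟨(a, b), rfl⟩) p)
  exact ne_bot_of_le_ne_bot (EReal.coe_ne_bot _) hle

/-- Lemma 6, extraction of an MMC from Karp's formula.
Let `G` be a finite directed weighted graph containing at least one cycle, `o` a
source vertex from which every vertex is reachable, `μ` the minimum mean weight
over all cycles, and `v*` a vertex attaining the minimum in Karp's formula
(so that the inner maximum at `v*` equals `μ`, with `F(|V|, v*) < ∞`).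
Then every cycle contained (as a contiguous subsequence, i.e. an infix) in a
path from `o` to `v*` with exactly `|V|` edges and weight `F(|V|, v*)` is a
minimum-mean cycle: its mean weight equals `μ`. -/
theorem stmt6 {V : Type*} [Fintype V] (E : V → V → Prop) (w : V → V → ℝ) (o : V)
    (hreach : ∀ v : V, ∃ p : List V,
      IsWalk E p ∧ p.head? = some o ∧ p.getLast? = some v)
    (hcyc : ∃ c : List V, IsCycle E c)
    (μ : ℝ) (hμ : IsLeast {m : ℝ | ∃ c, IsCycle E c ∧ m = meanWeight w c} μ)
    (vstar : V) (hfin : FVal E w o (Fintype.card V) vstar ≠ ⊤)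
    (hvstar : IsGreatest {s : ℝ | ∃ k ≤ Fintype.card V - 1, FVal E w o k vstar ≠ ⊤ ∧
        s = ((FVal E w o (Fintype.card V) vstar).toReal - (FVal E w o k vstar).toReal) /
            ((Fintype.card V : ℝ) - (k : ℝ))} μ) :
    ∀ p : List V, IsWalk E p → p.head? = some o → p.getLast? = some vstar →
      numEdges p = Fintype.card V →
      (pathWeight w p : EReal) = FVal E w o (Fintype.card V) vstar →
      ∀ c : List V, IsCycle E c → c <:+: p → meanWeight w c = μ := by
  rintro p hp ho hv hn hF c hc ⟨s, t, rfl⟩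
  have hμc : μ ≤ meanWeight w c := hμ.2 ⟨c, hc, rfl⟩
  refine le_antisymm ?_ hμc
  obtain ⟨x, m, rfl⟩ := hc.exists_eq
  have hweight := pathWeight_append_cycle w s x m t
  have hedges : numEdges (s ++ x :: t) + numEdges (x :: m ++ [x]) = Fintype.card V := by
    rw [← hn]
    simp only [numEdges, List.length_append, List.length_cons, List.length_nil]
    omega
  have hpos : 0 < numEdges (x :: m ++ [x]) := by simp [numEdges]
  have hlast : (s ++ x :: t).getLast? = some vstar := by
    rw [← hv, show s ++ (x :: m ++ [x]) ++ t = (s ++ x :: m) ++ x :: t by simp,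
      List.getLast?_append_cons, List.getLast?_append_cons]
  have hle := FVal_le w hp.remove_cycle (o := o) (v := vstar)
    (by simpa [List.head?_append] using ho) hlast
  have htop := ne_top_of_le_ne_top (EReal.coe_ne_top _) hle
  have hreal := EReal.toReal_le_toReal hle (FVal_ne_bot E w o _ vstar) (EReal.coe_ne_top _)
  have hmax := hvstar.2 ⟨numEdges (s ++ x :: t), by omega, htop, rfl⟩
  rw [← hF, ← hedges] at hmax
  simp only [EReal.toReal_coe] at hmax hreal
  have hpos' : (0 : ℝ) < numEdges (x :: m ++ [x]) := by exact_mod_cast hpos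
  rw [Nat.cast_add, add_sub_cancel_left, div_le_iff₀ hpos'] at hmax
  rw [meanWeight, div_le_iff₀ hpos']
  linarith
end

section
/- Consider a finite deterministic controlled system with state set X, action set A, nonempty admissible-action sets A(x), transition map f, and stage cost g, and let G_o be its OSTG from an initial state x₀ ∈ X. Then G_o contains at least one cycle; let μ* be the minimum mean weight over all cycles of G_o. The optimal infinite-horizon average cost from x₀ satisfies: (i) for every infinite admissible trajectory (x(t), a(t))_{t ≥ 0} from x₀, liminf_{T → ∞} (1/T) Σ_{t=0}^{T−1} g(x(t), a(t)) ≥ μ*; and (ii) there exists an infinite admissible trajectory from x₀, eventually periodic, for which lim_{T → ∞} (1/T) Σ_{t=0}^{T−1} g(x(t), a(t)) = μ*. Hence the infimum of the long-run average cost over all admissible action sequences from x₀ equals μ* and is attained. -/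
/-- `Reach Adm f x0 x`: the state `x` is reachable from `x0` by an admissible
trajectory of the controlled system with admissible-action sets `Adm` and
transition map `f`. -/
def Reach {X A : Type*} (Adm : X → Set A) (f : X → A → X) (x0 x : X) : Prop :=
  ∃ (k : ℕ) (y : ℕ → X) (b : ℕ → A), y 0 = x0 ∧ y k = x ∧
    ∀ t < k, b t ∈ Adm (y t) ∧ y (t + 1) = f (y t) (b t)

/-- The edge relation of the optimal state transition graph (OSTG) from `x0`:
there is an edge `(x, y)` iff `x` is reachable from `x0` and some admissible
action at `x` steers the system to `y`. -/
def OEdge {X A : Type*} (Adm : X → Set A) (f : X → A → X) (x0 : X)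
    (x y : X) : Prop :=
  Reach Adm f x0 x ∧ ∃ a ∈ Adm x, f x a = y

/-- The edge weight of the OSTG:
`w(x, y) = min { g(x, a) : a ∈ Adm x, f x a = y }`. -/
noncomputable def OWeight {X A : Type*} (Adm : X → Set A) (f : X → A → X)
    (g : X → A → ℝ) (x y : X) : ℝ :=
  sInf {r : ℝ | ∃ a ∈ Adm x, f x a = y ∧ r = g x a}

theorem pathWeight_eq_sum {V : Type*} (w : V → V → ℝ) (d : V) (p : List V) :
    pathWeight w p = ∑ k ∈ Finset.range (p.length - 1), w (p.getD k d) (p.getD (k + 1) d) := by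
  induction p with
  | nil => simp [pathWeight]
  | cons a l ih =>
    cases l with
    | nil => simp [pathWeight]
    | cons b l =>
      have h : pathWeight w (a :: b :: l) = w a b + pathWeight w (b :: l) := by
        simp [pathWeight]
      rw [h, ih]
      simp only [List.length_cons, Nat.add_sub_cancel]
      rw [Finset.sum_range_succ', add_comm]
      simp

theorem pathWeight_map_range {V : Type*} (w : V → V → ℝ) (v : ℕ → V) (n : ℕ) :
    pathWeight w ((List.range (n + 1)).map v) =
      ∑ k ∈ Finset.range n, w (v k) (v (k + 1)) := by
  rw [pathWeight_eq_sum w (v 0)]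
  simp only [List.length_map, List.length_range, Nat.add_sub_cancel]
  refine Finset.sum_congr rfl fun k hk => ?_
  have hk := Finset.mem_range.1 hk
  have h1 : k < n + 1 := by omega
  simp [List.getD, h1, hk]

theorem isCycle_map_range {V : Type*} {E : V → V → Prop} {v : ℕ → V} {n : ℕ} (hn : 1 ≤ n)
    (hv : ∀ k < n, E (v k) (v (k + 1))) (hc : v 0 = v n) :
    IsCycle E ((List.range (n + 1)).map v) := by
  refine ⟨⟨by simp, ?_⟩, by simpa using hn, ?_⟩
  · refine List.isChain_iff_getElem.2 fun i hi => ?_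
    simp only [List.length_map, List.length_range] at hi
    simpa using hv i (by omega)
  · simp [List.head?_range, List.getLast?_range, hc]

theorem meanWeight_map_range {V : Type*} (w : V → V → ℝ) (v : ℕ → V) (n : ℕ) :
    meanWeight w ((List.range (n + 1)).map v) =
      (∑ k ∈ Finset.range n, w (v k) (v (k + 1))) / n := by
  simp [meanWeight, pathWeight_map_range, numEdges]

/-- Every cycle is traced out by a function on the naturals. -/
theorem IsCycle.exists_fun {V : Type*} {E : V → V → Prop} {c : List V} (hc : IsCycle E c)
    (w : V → V → ℝ) :
    ∃ (v : ℕ → V) (n : ℕ), 1 ≤ n ∧ (∀ k < n, E (v k) (v (k + 1))) ∧ v 0 = v n ∧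
      meanWeight w c = (∑ k ∈ Finset.range n, w (v k) (v (k + 1))) / n := by
  obtain ⟨⟨hne, hch⟩, hlen, hends⟩ := hc
  refine ⟨fun k => c.getD k (c.head hne), c.length - 1, by omega, fun k hk => ?_, ?_, ?_⟩
  · have := List.isChain_iff_getElem.1 hch k (by omega)
    have h1 : k < c.length := by omega
    have h2 : k + 1 < c.length := by omega
    simpa [List.getD, h1, h2] using this
  · rw [List.head?_eq_getElem?, List.getLast?_eq_getElem?] at hends
    simp [List.getD, hends]
  · rw [meanWeight, pathWeight_eq_sum w (c.head hne), numEdges]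

theorem exists_lt_le_card_eq {V : Type*} [Fintype V] (v : ℕ → V) :
    ∃ i j, i < j ∧ j ≤ Fintype.card V ∧ v i = v j := by
  obtain ⟨i, j, hij, h⟩ := Fintype.exists_ne_map_eq_of_card_lt
    (fun k : Fin (Fintype.card V + 1) => v k) (by simp)
  have hne : (i : ℕ) ≠ j := fun h => hij (Fin.ext h)
  rcases lt_or_gt_of_ne hne with h1 | h1
  · exact ⟨i, j, h1, by omega, h⟩
  · exact ⟨j, i, h1, by omega, h.symm⟩

/-- Excising short closed subwalks of weight at least `m` per edge reduces any walk to one with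
fewer edges than there are vertices, without increasing the excess over `m`. -/
theorem exists_short_walk {V : Type*} [Fintype V] {E : V → V → Prop} {w : V → V → ℝ} {m : ℝ}
    (hm : ∀ (v : ℕ → V) (n : ℕ), 1 ≤ n → n ≤ Fintype.card V →
      (∀ k < n, E (v k) (v (k + 1))) → v 0 = v n →
      m * n ≤ ∑ k ∈ Finset.range n, w (v k) (v (k + 1)))
    (n : ℕ) (v : ℕ → V) (hv : ∀ k < n, E (v k) (v (k + 1))) :
    ∃ (n' : ℕ) (u : ℕ → V), n' < Fintype.card V ∧ (∀ k < n', E (u k) (u (k + 1))) ∧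
      u 0 = v 0 ∧ u n' = v n ∧
      ∑ k ∈ Finset.range n', w (u k) (u (k + 1)) - m * n' ≤
        ∑ k ∈ Finset.range n, w (v k) (v (k + 1)) - m * n := by
  induction n using Nat.strong_induction_on generalizing v with
  | _ n ih =>
    by_cases hn : n < Fintype.card V
    · exact ⟨n, v, hn, hv, rfl, rfl, le_rfl⟩
    obtain ⟨i, j, hij, hj, he⟩ := exists_lt_le_card_eq v
    obtain ⟨d, rfl⟩ : ∃ d, j = i + d := ⟨j - i, by omega⟩
    obtain ⟨r, rfl⟩ : ∃ r, n = i + d + r := ⟨n - (i + d), by omega⟩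
    set u : ℕ → V := fun k => if k < i then v k else v (k + d) with hu
    have hlow : ∀ k ≤ i, u k = v k := fun k hk => by
      rcases hk.lt_or_eq with h | rfl
      · simp [hu, h]
      · simp [hu, he]
    have hhigh : ∀ k, u (i + k) = v (i + d + k) := fun k => by
      simp [hu, show i + k + d = i + d + k by omega]
    have huE : ∀ k < i + r, E (u k) (u (k + 1)) := fun k hk => by
      by_cases h : k < i
      · rw [hlow k h.le, hlow (k + 1) h]
        exact hv k (by omega)
      · obtain ⟨s, rfl⟩ : ∃ s, k = i + s := ⟨k - i, by omega⟩
        rw [hhigh, add_assoc i s 1, hhigh]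
        exact hv (i + d + s) (by omega)
    obtain ⟨n', u', h1, h2, h3, h4, h5⟩ := ih (i + r) (by omega) u huE
    refine ⟨n', u', h1, h2, h3.trans (hlow 0 (Nat.zero_le _)), h4.trans (hhigh r), h5.trans ?_⟩
    have hin := hm (fun k => v (i + k)) d (by omega) (by omega)
      (fun k hk => hv (i + k) (by omega)) (by simpa using he)
    rw [Finset.sum_range_add, Finset.sum_range_add _ (i + d), Finset.sum_range_add _ i d]
    have e1 : ∑ k ∈ Finset.range i, w (u k) (u (k + 1)) =
        ∑ k ∈ Finset.range i, w (v k) (v (k + 1)) :=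
      Finset.sum_congr rfl fun k hk => by
        have hk := Finset.mem_range.1 hk
        rw [hlow k hk.le, hlow (k + 1) hk]
    have e2 : ∑ k ∈ Finset.range r, w (u (i + k)) (u (i + k + 1)) =
        ∑ k ∈ Finset.range r, w (v (i + d + k)) (v (i + d + k + 1)) :=
      Finset.sum_congr rfl fun k _ => by
        rw [hhigh, add_assoc i k 1, hhigh, ← add_assoc (i + d) k 1]
    rw [e1, e2]
    simp only [← add_assoc] at hin
    push_cast
    linarith

/-- In a finite weighted digraph with an infinite walk, some cycle has minimum mean weight, and
this mean bounds the weight of every walk from below up to an additive constant. -/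
theorem exists_isCycle_min_meanWeight {V : Type*} [Fintype V] (E : V → V → Prop)
    (w : V → V → ℝ) (x : ℕ → V) (hx : ∀ k, E (x k) (x (k + 1))) :
    ∃ c, IsCycle E c ∧ (∀ c', IsCycle E c' → meanWeight w c ≤ meanWeight w c') ∧
      ∃ C : ℝ, ∀ (v : ℕ → V) (n : ℕ), (∀ k < n, E (v k) (v (k + 1))) →
        meanWeight w c * n - C ≤ ∑ k ∈ Finset.range n, w (v k) (v (k + 1)) := by
  have hfin : {c : List V | IsCycle E c ∧ c.length ≤ Fintype.card V + 1}.Finite :=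
    (List.finite_length_le V (Fintype.card V + 1)).subset fun c hc => hc.2
  obtain ⟨c, ⟨hc, -⟩, hmin⟩ := Set.exists_min_image _ (meanWeight w) hfin (by
    obtain ⟨i, j, hij, hj, he⟩ := exists_lt_le_card_eq x
    refine ⟨_, isCycle_map_range (v := fun k => x (i + k)) (n := j - i) (by omega)
      (fun k _ => hx (i + k)) (by simp [he, hij.le]), ?_⟩
    simp only [List.length_map, List.length_range]
    omega)
  have hm : ∀ (v : ℕ → V) (n : ℕ), 1 ≤ n → n ≤ Fintype.card V →
      (∀ k < n, E (v k) (v (k + 1))) → v 0 = v n →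
      meanWeight w c * n ≤ ∑ k ∈ Finset.range n, w (v k) (v (k + 1)) := by
    intro v n hn hnc hv h0
    have h := hmin _ ⟨isCycle_map_range hn hv h0, by simpa using hnc⟩
    rw [meanWeight_map_range] at h
    exact (le_div_iff₀ (by exact_mod_cast hn)).1 h
  set m := meanWeight w c
  refine ⟨c, hc, fun c' hc' => ?_, ?_⟩
  · obtain ⟨v, n, hn, hv, h0, hw⟩ := hc'.exists_fun w
    obtain ⟨n', u, h1, h2, h3, h4, h5⟩ := exists_short_walk hm n v hv
    rw [hw, le_div_iff₀ (by exact_mod_cast hn)]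
    rcases Nat.eq_zero_or_pos n' with rfl | hpos
    · simp at h5
      linarith
    · have := hm u n' hpos h1.le h2 (by rw [h3, h4, h0])
      linarith
  · obtain ⟨B, hB⟩ : ∃ B, ∀ e : V × V, |w e.1 e.2| ≤ B := by
      obtain ⟨B, hB⟩ := (Set.finite_range fun e : V × V => |w e.1 e.2|).bddAbove
      exact ⟨B, fun e => hB ⟨e, rfl⟩⟩
    have hB0 : 0 ≤ B := (abs_nonneg _).trans (hB (x 0, x 0))
    refine ⟨Fintype.card V * (B + |m|), fun v n hv => ?_⟩
    obtain ⟨n', u, h1, -, -, -, h5⟩ := exists_short_walk hm n v hv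
    have h6 : -(n' * (B + |m|)) ≤ ∑ k ∈ Finset.range n', w (u k) (u (k + 1)) - m * n' := by
      have : ∑ k ∈ Finset.range n', (-(B + |m|)) ≤
          ∑ k ∈ Finset.range n', (w (u k) (u (k + 1)) - m) :=
        Finset.sum_le_sum fun k _ => by
          have := neg_le_of_abs_le (hB (u k, u (k + 1)))
          have := le_abs_self m
          simp only at *
          linarith
      simp only [Finset.sum_sub_distrib, Finset.sum_const, Finset.card_range, nsmul_eq_mul] at this
      linarith
    have h7 : (n' : ℝ) * (B + |m|) ≤ Fintype.card V * (B + |m|) := by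
      have : (n' : ℝ) ≤ Fintype.card V := by exact_mod_cast h1.le
      gcongr
    linarith

theorem tendsto_sub_div_natCast (μ C : ℝ) :
    Filter.Tendsto (fun T : ℕ => μ - C / (T : ℝ)) Filter.atTop (nhds μ) := by
  simpa using tendsto_const_nhds.sub (tendsto_const_div_atTop_nhds_zero_nat C)

theorem le_liminf_average {G : ℕ → ℝ} {μ B C : ℝ} (hB : ∀ t, G t ≤ B)
    (hC : ∀ T : ℕ, μ * T - C ≤ ∑ t ∈ Finset.range T, G t) :
    μ ≤ Filter.liminf (fun T : ℕ => (∑ t ∈ Finset.range T, G t) / (T : ℝ)) Filter.atTop := by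
  have hlim := tendsto_sub_div_natCast μ C
  rw [← hlim.liminf_eq]
  refine Filter.liminf_le_liminf ?_ hlim.isBoundedUnder_ge ?_
  · filter_upwards [Filter.eventually_gt_atTop 0] with T hT
    have hT : (0 : ℝ) < T := by exact_mod_cast hT
    rw [le_div_iff₀ hT, sub_mul, div_mul_cancel₀ _ hT.ne']
    exact hC T
  · refine Filter.IsBoundedUnder.isCoboundedUnder_ge ⟨B, ?_⟩
    rw [Filter.eventually_map]
    filter_upwards [Filter.eventually_gt_atTop 0] with T hT
    have hT : (0 : ℝ) < T := by exact_mod_cast hT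
    rw [div_le_iff₀ hT]
    calc ∑ t ∈ Finset.range T, G t ≤ ∑ t ∈ Finset.range T, B := Finset.sum_le_sum fun t _ => hB t
      _ = B * T := by simp [mul_comm]

/-- The averages of an eventually periodic sequence converge to its mean over one period. -/
theorem tendsto_average_of_eventually_periodic {G : ℕ → ℝ} {μ : ℝ} {T₀ L : ℕ} (hL : 1 ≤ L)
    (hper : ∀ t, T₀ ≤ t → G (t + L) = G t)
    (hsum : ∑ s ∈ Finset.range L, G (T₀ + s) = μ * L) :
    Filter.Tendsto (fun T : ℕ => (∑ t ∈ Finset.range T, G t) / (T : ℝ))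
      Filter.atTop (nhds μ) := by
  set D : ℕ → ℝ := fun T => ∑ t ∈ Finset.range T, G t - μ * T with hD
  have hDper : ∀ T, T₀ ≤ T → D (T + L) = D T := by
    intro T hT
    induction T, hT using Nat.le_induction with
    | base =>
      simp only [hD, Finset.sum_range_add, hsum]
      push_cast
      ring
    | succ T hT ih =>
      simp only [hD] at ih ⊢
      rw [show T + 1 + L = (T + L) + 1 by omega, Finset.sum_range_succ, Finset.sum_range_succ,
        hper T hT]
      push_cast at ih ⊢
      linarith
  have hval : ∀ T, ∃ T' < T₀ + L, D T = D T' := by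
    intro T
    induction T using Nat.strong_induction_on with
    | _ T ih =>
      by_cases h : T < T₀ + L
      · exact ⟨T, h, rfl⟩
      obtain ⟨T', h1, h2⟩ := ih (T - L) (by omega)
      refine ⟨T', h1, ?_⟩
      rw [← h2, ← hDper (T - L) (by omega), Nat.sub_add_cancel (by omega)]
  obtain ⟨C, hC⟩ : ∃ C, ∀ T, |D T| ≤ C := by
    refine ⟨∑ T ∈ Finset.range (T₀ + L), |D T|, fun T => ?_⟩
    obtain ⟨T', h1, h2⟩ := hval T
    rw [h2]
    exact Finset.single_le_sum (f := fun T => |D T|) (fun _ _ => abs_nonneg _)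
      (Finset.mem_range.2 h1)
  have hupper := tendsto_sub_div_natCast μ (-C)
  refine tendsto_of_tendsto_of_tendsto_of_le_of_le' (tendsto_sub_div_natCast μ C) hupper ?_ ?_
  all_goals
    filter_upwards [Filter.eventually_gt_atTop 0] with T hT
    have hT : (0 : ℝ) < T := by exact_mod_cast hT
    have := abs_le.1 (hC T)
    simp only [hD] at this
  · rw [le_div_iff₀ hT, sub_mul, div_mul_cancel₀ _ hT.ne']
    linarith
  · rw [div_le_iff₀ hT, sub_mul, div_mul_cancel₀ _ hT.ne']
    linarith

section OSTG

variable {X A : Type*} {Adm : X → Set A} {f : X → A → X} {x0 : X}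

theorem oEdge_of_trajectory {x : ℕ → X} {a : ℕ → A} (h0 : x 0 = x0)
    (ha : ∀ t, a t ∈ Adm (x t)) (hx : ∀ t, x (t + 1) = f (x t) (a t)) (t : ℕ) :
    OEdge Adm f x0 (x t) (x (t + 1)) :=
  ⟨⟨t, x, a, h0, rfl, fun s _ => ⟨ha s, hx s⟩⟩, a t, ha t, (hx t).symm⟩

theorem finite_edge_costs [Finite A] (g : X → A → ℝ) (x y : X) :
    {r : ℝ | ∃ a ∈ Adm x, f x a = y ∧ r = g x a}.Finite :=
  (Set.finite_range (g x)).subset (by rintro r ⟨a, -, -, rfl⟩; exact ⟨a, rfl⟩)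

theorem OWeight_le [Finite A] (g : X → A → ℝ) {x : X} {a : A} (ha : a ∈ Adm x) :
    OWeight Adm f g x (f x a) ≤ g x a :=
  csInf_le (finite_edge_costs g x _).bddBelow ⟨a, ha, rfl, rfl⟩

theorem OEdge.exists_action [Finite A] (g : X → A → ℝ) {x y : X} (h : OEdge Adm f x0 x y) :
    ∃ a ∈ Adm x, f x a = y ∧ OWeight Adm f g x y = g x a := by
  obtain ⟨-, a, ha, hy⟩ := h
  exact Set.Nonempty.csInf_mem (s := {r : ℝ | ∃ a ∈ Adm x, f x a = y ∧ r = g x a})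
    ⟨_, a, ha, hy, rfl⟩ (finite_edge_costs g x y)

/-- Reaching a closed walk and then circulating along it at minimal cost is admissible. -/
theorem exists_eventually_periodic_trajectory [Finite A] (g : X → A → ℝ) {v : ℕ → X} {n : ℕ}
    (hn : 1 ≤ n) (hv : ∀ k < n, OEdge Adm f x0 (v k) (v (k + 1))) (hc : v 0 = v n) :
    ∃ (x : ℕ → X) (a : ℕ → A) (T₀ : ℕ), x 0 = x0 ∧ (∀ t, a t ∈ Adm (x t)) ∧
      (∀ t, x (t + 1) = f (x t) (a t)) ∧
      (∀ t, T₀ ≤ t → x (t + n) = x t ∧ a (t + n) = a t) ∧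
      ∀ s < n, g (x (T₀ + s)) (a (T₀ + s)) = OWeight Adm f g (v s) (v (s + 1)) := by
  obtain ⟨T₀, y, b, hy0, hyT, hyb⟩ := (hv 0 hn).1
  have hmod : ∀ t, t % n < n := fun t => Nat.mod_lt t hn
  choose α hα hfα hgα using fun t => (hv (t % n) (hmod t)).exists_action g
  have hnext : ∀ t, v (t % n + 1) = v ((t + 1) % n) := fun t => by
    rw [← Nat.mod_add_mod]
    rcases (show t % n + 1 ≤ n from hmod t).lt_or_eq with h | h
    · rw [Nat.mod_eq_of_lt h]
    · rw [h, Nat.mod_self, hc]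
  refine ⟨fun t => if t < T₀ then y t else v ((t - T₀) % n),
    fun t => if t < T₀ then b t else α ((t - T₀) % n), T₀, ?_, fun t => ?_, fun t => ?_,
    fun t ht => ?_, fun s hs => ?_⟩
  · by_cases h : 0 < T₀
    · simp [h, hy0]
    · obtain rfl : T₀ = 0 := by omega
      simp [← hyT, hy0]
  · by_cases h : t < T₀
    · simpa [h] using (hyb t h).1
    · simpa [h] using hα ((t - T₀) % n)
  · by_cases h : t < T₀
    · rcases (show t + 1 ≤ T₀ from h).lt_or_eq with h1 | h1
      · simpa [h, h1] using (hyb t h).2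
      · have := (hyb t h).2
        rw [h1, hyT] at this
        simpa [h, h1] using this
    · have h1 : ¬ t + 1 < T₀ := by omega
      have := hfα ((t - T₀) % n)
      rw [Nat.mod_mod, hnext] at this
      simp [h, h1, this, show t + 1 - T₀ = t - T₀ + 1 by omega]
  · have h1 : ¬ t < T₀ := by omega
    have h2 : ¬ t + n < T₀ := by omega
    simp [h1, h2, show t + n - T₀ = t - T₀ + n by omega]
  · have := hgα s
    rw [Nat.mod_eq_of_lt hs] at this
    simp [Nat.mod_eq_of_lt hs, this]

end OSTG

/-- Theorem 1: the optimal infinite-horizon average cost from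
`x₀` equals the minimum cycle mean `μ` of the OSTG and is attained. The OSTG
from `x₀` contains at least one cycle, and its minimum mean cycle weight `μ`
(which exists and is attained) satisfies: (i) every infinite admissible
trajectory from `x₀` has long-run average cost (liminf) at least `μ`; and
(ii) some eventually periodic infinite admissible trajectory from `x₀` has
long-run average cost converging to `μ`. Hence the infimum of the long-run
average cost over admissible action sequences from `x₀` equals `μ` and is
attained. -/
theorem stmt14 {X A : Type*} [Fintype X] [Fintype A]
    (Adm : X → Set A) (hAdm : ∀ x : X, (Adm x).Nonempty)
    (f : X → A → X) (g : X → A → ℝ) (x0 : X) :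
    ∃ μ : ℝ,
      IsLeast {m : ℝ | ∃ c : List X, IsCycle (OEdge Adm f x0) c ∧
        m = meanWeight (OWeight Adm f g) c} μ ∧
      (∀ (x : ℕ → X) (a : ℕ → A), x 0 = x0 →
        (∀ t : ℕ, a t ∈ Adm (x t)) → (∀ t : ℕ, x (t + 1) = f (x t) (a t)) →
        μ ≤ Filter.liminf
          (fun T : ℕ => (∑ t ∈ Finset.range T, g (x t) (a t)) / (T : ℝ))
          Filter.atTop) ∧
      (∃ (x : ℕ → X) (a : ℕ → A) (T0 L : ℕ), 1 ≤ L ∧ x 0 = x0 ∧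
        (∀ t : ℕ, a t ∈ Adm (x t)) ∧ (∀ t : ℕ, x (t + 1) = f (x t) (a t)) ∧
        (∀ t : ℕ, T0 ≤ t → x (t + L) = x t ∧ a (t + L) = a t) ∧
        Filter.Tendsto
          (fun T : ℕ => (∑ t ∈ Finset.range T, g (x t) (a t)) / (T : ℝ))
          Filter.atTop (nhds μ)) := by
  choose act hact using hAdm
  have hE : ∀ k, OEdge Adm f x0 (((fun y => f y (act y))^[k]) x0)
      (((fun y => f y (act y))^[k + 1]) x0) :=
    oEdge_of_trajectory (x := fun k => ((fun y => f y (act y))^[k]) x0)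
      (a := fun k => act (((fun y => f y (act y))^[k]) x0)) rfl (fun _ => hact _)
      (fun k => Function.iterate_succ_apply' _ k x0)
  obtain ⟨c, hc, hmin, C, hC⟩ :=
    exists_isCycle_min_meanWeight (OEdge Adm f x0) (OWeight Adm f g) _ hE
  refine ⟨meanWeight (OWeight Adm f g) c, ⟨⟨c, hc, rfl⟩, ?_⟩, fun x a h0 ha hx => ?_, ?_⟩
  · rintro _ ⟨c', hc', rfl⟩
    exact hmin c' hc'
  · obtain ⟨B, hB⟩ := (Set.finite_range fun e : X × A => g e.1 e.2).bddAbove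
    refine le_liminf_average (C := C) (fun t => hB ⟨(x t, a t), rfl⟩) fun T =>
      (hC x T fun k _ => oEdge_of_trajectory h0 ha hx k).trans
        (Finset.sum_le_sum fun t _ => ?_)
    rw [hx t]
    exact OWeight_le g (ha t)
  · obtain ⟨v, n, hn, hv, hv0, hw⟩ := hc.exists_fun (OWeight Adm f g)
    obtain ⟨x, a, T₀, h0, ha, hx, hper, hcost⟩ :=
      exists_eventually_periodic_trajectory g hn hv hv0
    refine ⟨x, a, T₀, n, hn, h0, ha, hx, hper, tendsto_average_of_eventually_periodic hn
      (fun t ht => by rw [(hper t ht).1, (hper t ht).2]) ?_⟩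
    have hn0 : (n : ℝ) ≠ 0 := by exact_mod_cast (show n ≠ 0 by omega)
    rw [hw, div_mul_cancel₀ _ hn0]
    exact Finset.sum_congr rfl fun s hs => hcost s (Finset.mem_range.1 hs)
end
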